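/- arXiv:2207.14457 — 2 statements merged into one kernel-verified Lean document; each statement's English description precedes it below -/
import Mathlib

section
/- Let M ≥ 3 be a natural number, let D be a finite set of positive real numbers, and for each i ∈ {1,…,M} and d ∈ D let A_i(d) be a natural number such that Σ_{d∈D} A_i(d) = M − 1 for every i. Let E > 0 and σ > 0. Let f : ℝ → ℝ be continuous with f(x) = 0 for x < 0, f(x) > 0 for x > 0, and ∫_ℝ f(x) dx = 1. Define G(γ) = ∫_{−∞}^{γ} f(x) dx + (1/M) Σ_{i=1}^{M} Σ_{d∈D} A_i(d) ∫_{γ}^{∞} Q(d·√(E·x/(2σ²))) f(x) dx, and let γ* ∈ [0, ∞) satisfy (1/M) Σ_{i=1}^{M} Σ_{d∈D} A_i(d) · Q(d·√(E·γ*/(2σ²))) = 1. Then G is strictly decreasing on [0, γ*] and strictly increasing on [γ*, ∞). -/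
open MeasureTheory Real

/-- The Gaussian Q-function: `Q x = (1/√(2π)) ∫_{x}^{∞} e^{−t²/2} dt`. -/
noncomputable def gaussianQ (x : ℝ) : ℝ :=
  (1 / Real.sqrt (2 * Real.pi)) * ∫ t in Set.Ioi x, Real.exp (-t ^ 2 / 2)

lemma integrable_exp_neg_sq_half : Integrable fun t : ℝ => Real.exp (-t ^ 2 / 2) := by
  have h := integrable_exp_neg_mul_sq (b := 1 / 2) (by norm_num)
  refine h.congr (.of_forall fun t => ?_)
  simp only
  congr 1
  ring

lemma gaussianQ_strictAnti : StrictAnti gaussianQ := by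
  intro a b hab
  have hsub := intervalIntegral.integral_Ioi_sub_Ioi
    (integrable_exp_neg_sq_half.integrableOn (s := Set.Ioi a)) hab.le
  have hpos : 0 < ∫ t in a..b, Real.exp (-t ^ 2 / 2) :=
    intervalIntegral.intervalIntegral_pos_of_pos_on
      integrable_exp_neg_sq_half.intervalIntegrable (fun t _ => Real.exp_pos _) hab
  have hc : 0 < 1 / Real.sqrt (2 * Real.pi) := by positivity
  exact mul_lt_mul_of_pos_left (by linarith) hc

lemma gaussianQ_nonneg (x : ℝ) : 0 ≤ gaussianQ x :=
  mul_nonneg (by positivity) (integral_nonneg fun t => (Real.exp_pos _).le)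

lemma integrable_gaussianQ_comp_mul {g f : ℝ → ℝ} (hg : Measurable g) (hg0 : ∀ x, 0 ≤ g x)
    (hf : Integrable f) : Integrable fun x => gaussianQ (g x) * f x := by
  refine hf.bdd_mul (c := gaussianQ 0)
    (gaussianQ_strictAnti.antitone.measurable.comp hg).aestronglyMeasurable
    (.of_forall fun x => ?_)
  rw [Real.norm_of_nonneg (gaussianQ_nonneg _)]
  exact gaussianQ_strictAnti.antitone (hg0 x)

lemma integral_Iio_add_integral_Ioi_sub {f h : ℝ → ℝ} (hf : Integrable f) (hh : Integrable h)
    {a b : ℝ} (hab : a ≤ b) :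
    ((∫ x in Set.Iio b, f x) + ∫ x in Set.Ioi b, h x) -
      ((∫ x in Set.Iio a, f x) + ∫ x in Set.Ioi a, h x) = ∫ x in a..b, (f x - h x) := by
  have h1 := intervalIntegral.integral_Iic_sub_Iic
    (hf.integrableOn (s := Set.Iic a)) (hf.integrableOn (s := Set.Iic b))
  have h2 := intervalIntegral.integral_Ioi_sub_Ioi (hh.integrableOn (s := Set.Ioi a)) hab
  rw [integral_Iic_eq_integral_Iio, integral_Iic_eq_integral_Iio] at h1
  rw [intervalIntegral.integral_sub hf.intervalIntegrable hh.intervalIntegrable]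
  linarith

theorem G_strictAntiOn_strictMonoOn
    (M : ℕ) (hM : 3 ≤ M)
    (D : Finset ℝ) (hD : ∀ d ∈ D, 0 < d)
    (A : Fin M → ℝ → ℕ) (hA : ∀ i, ∑ d ∈ D, A i d = M - 1)
    (E σ : ℝ) (hE : 0 < E) (hσ : 0 < σ)
    (f : ℝ → ℝ) (hf_cont : Continuous f)
    (hf_neg : ∀ x < (0 : ℝ), f x = 0)
    (hf_pos : ∀ x > (0 : ℝ), 0 < f x)
    (hf_int : ∫ x, f x = 1)
    (G : ℝ → ℝ)
    (hG : ∀ γ, G γ = (∫ x in Set.Iio γ, f x) +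
      (1 / (M : ℝ)) * ∑ i : Fin M, ∑ d ∈ D, (A i d : ℝ) *
        ∫ x in Set.Ioi γ, gaussianQ (d * Real.sqrt (E * x / (2 * σ ^ 2))) * f x)
    (γstar : ℝ) (hγstar : 0 ≤ γstar)
    (hroot : (1 / (M : ℝ)) * ∑ i : Fin M, ∑ d ∈ D, (A i d : ℝ) *
      gaussianQ (d * Real.sqrt (E * γstar / (2 * σ ^ 2))) = 1) :
    StrictAntiOn G (Set.Icc 0 γstar) ∧ StrictMonoOn G (Set.Ici γstar) := by
  have hM0 : (0 : ℝ) < 1 / (M : ℝ) := by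
    have : (0 : ℝ) < M := by exact_mod_cast (by omega : 0 < M)
    positivity
  have hf : Integrable f := by
    by_contra h
    rw [integral_undef h] at hf_int
    exact zero_ne_one hf_int
  set B : ℝ → ℝ := fun x => (1 / (M : ℝ)) * ∑ i : Fin M, ∑ d ∈ D, (A i d : ℝ) *
    gaussianQ (d * Real.sqrt (E * x / (2 * σ ^ 2))) with hB
  have hterm : ∀ d ∈ D,
      Integrable fun x => gaussianQ (d * Real.sqrt (E * x / (2 * σ ^ 2))) * f x := fun d hd =>
    integrable_gaussianQ_comp_mul (by fun_prop)
      (fun x => mul_nonneg (hD d hd).le (Real.sqrt_nonneg _)) hf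
  have hBf_eq : (fun x => B x * f x) = fun x => (1 / (M : ℝ)) * ∑ i : Fin M, ∑ d ∈ D,
      (A i d : ℝ) * (gaussianQ (d * Real.sqrt (E * x / (2 * σ ^ 2))) * f x) := by
    funext x
    simp only [hB, mul_assoc, Finset.sum_mul]
  have hBf : Integrable fun x => B x * f x := by
    rw [hBf_eq]
    exact (integrable_finsetSum _ fun i _ => integrable_finsetSum _ fun d hd =>
      (hterm d hd).const_mul _).const_mul _
  have hG' : ∀ γ, G γ = (∫ x in Set.Iio γ, f x) + ∫ x in Set.Ioi γ, B x * f x := by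
    intro γ
    rw [hG, hBf_eq, integral_const_mul, integral_finsetSum]
    · congr 2
      refine Finset.sum_congr rfl fun i _ => ?_
      rw [integral_finsetSum _ fun d hd => ((hterm d hd).const_mul _).integrableOn]
      simp only [integral_const_mul]
    · exact fun i _ => integrable_finsetSum _ fun d hd =>
        ((hterm d hd).const_mul _).integrableOn
  have hGsub : ∀ a b, a ≤ b → G b - G a = ∫ x in a..b, (f x - B x * f x) := fun a b hab => by
    rw [hG', hG', integral_Iio_add_integral_Ioi_sub hf hBf hab]
  have hB_anti : StrictAntiOn B (Set.Ici 0) := by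
    intro x hx y _ hxy
    have hlt : ∀ d ∈ D, gaussianQ (d * Real.sqrt (E * y / (2 * σ ^ 2))) <
        gaussianQ (d * Real.sqrt (E * x / (2 * σ ^ 2))) := by
      intro d hd
      have hx0 : 0 ≤ x := hx
      refine gaussianQ_strictAnti (mul_lt_mul_of_pos_left ?_ (hD d hd))
      refine Real.sqrt_lt_sqrt (by positivity) ?_
      gcongr
    refine mul_lt_mul_of_pos_left ?_ hM0
    have : Nonempty (Fin M) := ⟨⟨0, by omega⟩⟩
    refine Finset.sum_lt_sum_of_nonempty Finset.univ_nonempty fun i _ => ?_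
    obtain ⟨d, hd, hAd⟩ : ∃ d ∈ D, A i d ≠ 0 :=
      Finset.exists_ne_zero_of_sum_ne_zero (by rw [hA i]; omega)
    refine Finset.sum_lt_sum
      (fun e he => mul_le_mul_of_nonneg_left (hlt e he).le (Nat.cast_nonneg _)) ⟨d, hd, ?_⟩
    exact mul_lt_mul_of_pos_left (hlt d hd) (by exact_mod_cast Nat.pos_of_ne_zero hAd)
  have hroot' : B γstar = 1 := hroot
  constructor
  · rintro a ⟨ha, -⟩ b ⟨-, hb⟩ hab
    have hpos : 0 < ∫ x in a..b, (B x * f x - f x) := by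
      refine intervalIntegral.intervalIntegral_pos_of_pos_on
        (hBf.sub hf).intervalIntegrable (fun x hx => ?_) hab
      have hx0 : 0 < x := ha.trans_lt hx.1
      have hBx : 1 < B x := hroot' ▸ hB_anti hx0.le hγstar (hx.2.trans_le hb)
      nlinarith [hf_pos x hx0]
    have hneg : (∫ x in a..b, (f x - B x * f x)) = -∫ x in a..b, (B x * f x - f x) := by
      simp only [← intervalIntegral.integral_neg, neg_sub]
    linarith [hGsub a b hab.le]
  · intro a ha b _ hab
    have hpos : 0 < ∫ x in a..b, (f x - B x * f x) := by
      refine intervalIntegral.intervalIntegral_pos_of_pos_on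
        (hf.sub hBf).intervalIntegrable (fun x hx => ?_) hab
      have hxs : γstar < x := lt_of_le_of_lt ha hx.1
      have hx0 : 0 < x := hγstar.trans_lt hxs
      have hBx : B x < 1 := hroot' ▸ hB_anti hγstar hx0.le hxs
      nlinarith [hf_pos x hx0]
    linarith [hGsub a b hab.le]
end

section
/- Let d > 0, E > 0, σ > 0, λ > 0 and γ ≥ 0 be real numbers. Then ∫_{γ}^{∞} Q(d·√(E·x/(2σ²))) · (1/λ) · e^{−x/λ} dx = (1/π) ∫_{0}^{π/2} (4σ² sin²θ)/(d²Eλ + 4σ² sin²θ) · exp(−γ·(d²Eλ + 4σ² sin²θ)/(4λσ² sin²θ)) dθ. -/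
open MeasureTheory Real

theorem integral_Ioi_mul_exp_neg_sq_div_two (a : ℝ) :
    ∫ r in Set.Ioi a, r * Real.exp (-r ^ 2 / 2) = Real.exp (-a ^ 2 / 2) := by
  have hint : Integrable (fun r : ℝ => r * Real.exp (-r ^ 2 / 2)) := by
    convert integrable_mul_exp_neg_mul_sq (b := 1 / 2) (by norm_num) using 3
    ring_nf
  have hlim : Filter.Tendsto (fun r : ℝ => -Real.exp (-r ^ 2 / 2)) Filter.atTop (nhds 0) := by
    rw [← neg_zero]
    refine (Real.tendsto_exp_atBot.comp ?_).neg
    refine Filter.Tendsto.atBot_div_const (by norm_num) ?_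
    exact Filter.tendsto_neg_atTop_atBot.comp (Filter.tendsto_pow_atTop two_ne_zero)
  rw [integral_Ioi_of_hasDerivAt_of_tendsto' (f := fun r : ℝ => -Real.exp (-r ^ 2 / 2))
    (fun r _ => ?_) hint.integrableOn hlim]
  · ring
  · have h := (((hasDerivAt_pow 2 r).neg.div_const 2).exp).neg
    refine h.congr_deriv ?_
    simp only [Pi.neg_apply, Nat.cast_ofNat]
    ring

theorem polar_mem_quadrant_iff {x r θ : ℝ} (hx : 0 ≤ x) (hr : 0 < r)
    (hθ : θ ∈ Set.Ioo (-π) π) :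
    (0 < r * Real.cos θ ∧ x < r * Real.sin θ) ↔
      θ ∈ Set.Ioo 0 (π / 2) ∧ x / Real.sin θ < r := by
  constructor
  · rintro ⟨hc, hs⟩
    have hcos : 0 < Real.cos θ := pos_of_mul_pos_right hc hr.le
    have hsin : 0 < Real.sin θ := pos_of_mul_pos_right (hx.trans_lt hs) hr.le
    refine ⟨⟨?_, ?_⟩, (div_lt_iff₀ hsin).2 hs⟩
    · by_contra! h
      exact hsin.not_ge (sin_nonpos_of_nonpos_of_neg_pi_le h hθ.1.le)
    · by_contra! h
      exact hcos.not_ge (cos_nonpos_of_pi_div_two_le_of_le h (by linarith [hθ.2, pi_pos]))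
  · rintro ⟨h, hs⟩
    have hsin : 0 < Real.sin θ := sin_pos_of_pos_of_lt_pi h.1 hθ.2
    have hcos : 0 < Real.cos θ := cos_pos_of_mem_Ioo ⟨by linarith [h.1, pi_pos], h.2⟩
    exact ⟨mul_pos hr hcos, (div_lt_iff₀ hsin).1 hs⟩

/-- The integral of the unnormalised Gaussian over the half-strip `u > 0`, `v > x`, computed in
Cartesian and in polar coordinates. -/
theorem integral_Ioi_gaussian_mul_eq_polar {x : ℝ} (hx : 0 ≤ x) :
    (∫ t in Set.Ioi (0 : ℝ), Real.exp (-t ^ 2 / 2)) * ∫ t in Set.Ioi x, Real.exp (-t ^ 2 / 2) =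
      ∫ θ in Set.Ioo 0 (π / 2), Real.exp (-x ^ 2 / (2 * Real.sin θ ^ 2)) := by
  set g : ℝ → ℝ := fun t => Real.exp (-t ^ 2 / 2) with hg
  have hgm : Measurable g := by fun_prop
  set K : ℝ × ℝ → ℝ :=
    {p : ℝ × ℝ | p.2 ∈ Set.Ioo 0 (π / 2) ∧ x / Real.sin p.2 < p.1}.indicator
      (fun p => p.1 * g p.1) with hK
  have hset : MeasurableSet {p : ℝ × ℝ | p.2 ∈ Set.Ioo 0 (π / 2) ∧ x / Real.sin p.2 < p.1} :=
    (measurable_snd measurableSet_Ioo).inter (measurableSet_lt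
      (f := fun p : ℝ × ℝ => x / Real.sin p.2) (g := Prod.fst) (by fun_prop) (by fun_prop))
  have hKm : Measurable K := Measurable.indicator (by fun_prop) hset
  have hint : Integrable (fun r : ℝ => r * g r) := by
    convert integrable_mul_exp_neg_mul_sq (b := 1 / 2) (by norm_num) using 3
    simp only [hg]
    ring_nf
  have hKint : Integrable K
      ((volume.restrict (Set.Ioi 0)).prod (volume.restrict (Set.Ioo (-π) π))) := by
    refine Integrable.mono' (g := fun p => ‖p.1 * g p.1‖ * 1)
      (hint.norm.integrableOn.mul_prod (integrable_const (1 : ℝ))) hKm.aestronglyMeasurable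
      (Filter.Eventually.of_forall fun p => ?_)
    rw [mul_one]
    exact norm_indicator_le_norm_self _ _
  rw [← integral_indicator measurableSet_Ioi, ← integral_indicator measurableSet_Ioi,
    ← integral_prod_mul, ← Measure.volume_eq_prod, ← integral_comp_polarCoord_symm,
    polarCoord_target]
  have hcongr : Set.EqOn
      (fun p : ℝ × ℝ => p.1 • ((Set.Ioi 0).indicator g (polarCoord.symm p).1 *
        (Set.Ioi x).indicator g (polarCoord.symm p).2)) K (Set.Ioi 0 ×ˢ Set.Ioo (-π) π) := by
    rintro ⟨r, θ⟩ ⟨hr, hθ⟩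
    have hiff := polar_mem_quadrant_iff hx hr hθ
    have hexp : g (r * Real.cos θ) * g (r * Real.sin θ) = g r := by
      simp only [hg, ← Real.exp_add]
      congr 1
      linear_combination (-r ^ 2 / 2) * Real.sin_sq_add_cos_sq θ
    simp only [hK, Set.indicator_apply, Set.mem_ofPred_eq, ← hiff, polarCoord_symm_apply,
      Set.mem_Ioi, smul_eq_mul]
    by_cases h1 : 0 < r * Real.cos θ <;> by_cases h2 : x < r * Real.sin θ <;> simp [h1, h2, hexp]
  rw [setIntegral_congr_fun (measurableSet_Ioi.prod measurableSet_Ioo) hcongr,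
    Measure.volume_eq_prod, ← Measure.prod_restrict, integral_prod_symm _ hKint]
  have hinner : ∀ θ : ℝ, ∫ r in Set.Ioi 0, K (r, θ) =
      (Set.Ioo 0 (π / 2)).indicator (fun θ => Real.exp (-x ^ 2 / (2 * Real.sin θ ^ 2))) θ := by
    intro θ
    by_cases hθ : θ ∈ Set.Ioo 0 (π / 2)
    · have hsin : 0 < Real.sin θ :=
        sin_pos_of_pos_of_lt_pi hθ.1 (by linarith [hθ.2, pi_pos])
      have hslice : (fun r => K (r, θ)) =
          (Set.Ioi (x / Real.sin θ)).indicator (fun r => r * g r) := by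
        ext r
        simp only [hK, Set.indicator_apply, Set.mem_ofPred_eq, Set.mem_Ioi, hθ, true_and]
      rw [Set.indicator_of_mem hθ, hslice, setIntegral_indicator measurableSet_Ioi,
        Set.inter_eq_right.2 (Set.Ioi_subset_Ioi (div_nonneg hx hsin.le)),
        integral_Ioi_mul_exp_neg_sq_div_two]
      congr 1
      field_simp
    · have hslice : (fun r => K (r, θ)) = fun _ => 0 := by
        ext r
        simp only [hK, Set.indicator_apply, Set.mem_ofPred_eq, hθ, false_and, if_false]
      rw [Set.indicator_of_notMem hθ, hslice, integral_zero]
  simp_rw [hinner]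
  rw [setIntegral_indicator measurableSet_Ioo, Set.inter_eq_right.2]
  exact Set.Ioo_subset_Ioo (by linarith [pi_pos]) (by linarith [pi_pos])

/-- Craig's formula for the Gaussian Q-function. -/
theorem gaussianQ_eq_craig {x : ℝ} (hx : 0 ≤ x) :
    gaussianQ x =
      (1 / π) * ∫ θ in Set.Ioo 0 (π / 2), Real.exp (-x ^ 2 / (2 * Real.sin θ ^ 2)) := by
  have hhalf : ∫ t in Set.Ioi (0 : ℝ), Real.exp (-t ^ 2 / 2) = √(2 * π) / 2 := by
    convert integral_gaussian_Ioi (1 / 2) using 2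
    · ring_nf
    · ring_nf
  rw [← integral_Ioi_gaussian_mul_eq_polar hx, hhalf, gaussianQ, ← mul_assoc]
  congr 1
  have hsq : √(2 * π) ^ 2 = 2 * π := Real.sq_sqrt (by positivity)
  have hpos : 0 < √(2 * π) := by positivity
  field_simp
  linarith

/-- The average of Craig's formula for `Q (√(2 a x))` over the tail of an exponential law. -/
theorem integral_Ioi_craig_mul_exp {a lam : ℝ} (ha : 0 ≤ a) (hlam : 0 < lam) (γ : ℝ)
    (hγ : 0 ≤ γ) :
    ∫ x in Set.Ioi γ, (∫ θ in Set.Ioo 0 (π / 2), Real.exp (-(a * x) / Real.sin θ ^ 2)) *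
        ((1 / lam) * Real.exp (-x / lam)) =
      ∫ θ in Set.Ioo 0 (π / 2), Real.sin θ ^ 2 / (a * lam + Real.sin θ ^ 2) *
        Real.exp (-γ * (a / Real.sin θ ^ 2 + 1 / lam)) := by
  have hexp : IntegrableOn (fun x : ℝ => (1 / lam) * Real.exp (-x / lam)) (Set.Ioi γ) := by
    refine Integrable.const_mul ?_ _
    refine (exp_neg_integrableOn_Ioi γ (one_div_pos.2 hlam)).congr_fun (fun x _ => ?_)
      measurableSet_Ioi
    ring_nf
  simp_rw [← integral_mul_const]
  rw [integral_integral_swap]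
  · refine setIntegral_congr_fun measurableSet_Ioo fun θ hθ => ?_
    have hsin : 0 < Real.sin θ := sin_pos_of_pos_of_lt_pi hθ.1 (by linarith [hθ.2, pi_pos])
    have hc : 0 < a / Real.sin θ ^ 2 + 1 / lam := by positivity
    have hmerge : ∀ x : ℝ, Real.exp (-(a * x) / Real.sin θ ^ 2) *
        ((1 / lam) * Real.exp (-x / lam)) =
          (1 / lam) * Real.exp (-(a / Real.sin θ ^ 2 + 1 / lam) * x) := by
      intro x
      rw [mul_left_comm, ← Real.exp_add]
      ring_nf
    simp only [hmerge]
    rw [integral_const_mul, integral_exp_mul_Ioi (neg_lt_zero.2 hc), neg_div_neg_eq,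
      neg_mul_comm, mul_comm _ (-γ)]
    field_simp
  · refine Integrable.mono'
      (g := fun p : ℝ × ℝ => (1 / lam) * Real.exp (-p.1 / lam) * 1)
      (Integrable.mul_prod hexp (integrable_const (1 : ℝ)))
      (Measurable.aestronglyMeasurable (by unfold Function.uncurry; fun_prop)) ?_
    rw [Measure.prod_restrict]
    refine (ae_restrict_iff' (measurableSet_Ioi.prod measurableSet_Ioo)).2
      (Filter.Eventually.of_forall ?_)
    rintro ⟨x, θ⟩ ⟨hx, -⟩
    have hx0 : 0 ≤ x := hγ.trans (le_of_lt hx)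
    simp only [Function.uncurry]
    rw [Real.norm_of_nonneg (by positivity), mul_one]
    refine mul_le_of_le_one_left (by positivity) (Real.exp_le_one_iff.2 ?_)
    exact div_nonpos_of_nonpos_of_nonneg (neg_nonpos.2 (by positivity)) (by positivity)

theorem pep_term_rayleigh (d E σ lam γ : ℝ)
    (hd : 0 < d) (hE : 0 < E) (hσ : 0 < σ) (hlam : 0 < lam) (hγ : 0 ≤ γ) :
    ∫ x in Set.Ioi γ,
        gaussianQ (d * Real.sqrt (E * x / (2 * σ ^ 2))) * ((1 / lam) * Real.exp (-x / lam)) =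
      (1 / Real.pi) * ∫ θ in (0 : ℝ)..(Real.pi / 2),
        (4 * σ ^ 2 * Real.sin θ ^ 2) / (d ^ 2 * E * lam + 4 * σ ^ 2 * Real.sin θ ^ 2) *
          Real.exp (-γ * (d ^ 2 * E * lam + 4 * σ ^ 2 * Real.sin θ ^ 2) /
            (4 * lam * σ ^ 2 * Real.sin θ ^ 2)) := by
  set a := d ^ 2 * E / (4 * σ ^ 2) with ha
  have hcraig : Set.EqOn
      (fun x => gaussianQ (d * √(E * x / (2 * σ ^ 2))) * ((1 / lam) * Real.exp (-x / lam)))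
      (fun x => (1 / π) * ((∫ θ in Set.Ioo 0 (π / 2), Real.exp (-(a * x) / Real.sin θ ^ 2)) *
        ((1 / lam) * Real.exp (-x / lam)))) (Set.Ioi γ) := by
    intro x hx
    have hx0 : 0 ≤ x := hγ.trans (le_of_lt hx)
    have hsq : (d * √(E * x / (2 * σ ^ 2))) ^ 2 = 2 * (a * x) := by
      rw [mul_pow, Real.sq_sqrt (by positivity), ha]
      field_simp
      norm_num
    simp only [gaussianQ_eq_craig (mul_nonneg hd.le (Real.sqrt_nonneg (E * x / (2 * σ ^ 2)))),
      hsq, ← mul_neg, mul_div_mul_left _ _ (two_ne_zero (α := ℝ))]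
    ring
  rw [setIntegral_congr_fun measurableSet_Ioi hcraig, integral_const_mul,
    integral_Ioi_craig_mul_exp (by positivity) hlam γ hγ,
    intervalIntegral.integral_of_le (by positivity), ← integral_Ioc_eq_integral_Ioo]
  congr 1
  refine setIntegral_congr_fun measurableSet_Ioc fun θ hθ => ?_
  have hsin : 0 < Real.sin θ := sin_pos_of_pos_of_lt_pi hθ.1 (by linarith [hθ.2, pi_pos])
  simp only [ha]
  congr 1
  · field_simp
  · congr 1
    field_simp
end
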